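/- For any invertible n×n matrices φ, ψ, g₁, g₂, g₃ over A and all τ, σ ∈ Der: P₂(g₁·φ·g₂⁻¹, g₂·ψ·g₃⁻¹)(τ,σ) = P₂(φ,ψ)(τ,σ) + Q(ψ;g₂,g₃)(τ,σ) − Q(φ·ψ;g₁,g₃)(τ,σ) + Q(φ;g₁,g₂)(τ,σ). (Section 3.5: the gauge-transformation identity p₂(ᵍφ) = p₂(φ) + d_Čech p₂(φ,g) for the change of cocycle ᵍφ_{ij} = g_i φ_{ij} g_j⁻¹.) -/

import Mathlib

noncomputable section

variable (k A : Type*) [Field k] [CharZero k] [CommRing A] [Algebra k A]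

/-- Entrywise application of a derivation to a matrix. -/
def dmat {n : ℕ} (τ : Derivation k A A) (φ : Matrix (Fin n) (Fin n) A) :
    Matrix (Fin n) (Fin n) A :=
  Matrix.of fun p q => τ (φ p q)

/-- One half, as an element of `A`. -/
def half : A := algebraMap k A 2⁻¹

/-- `P₂(φ,ψ)(τ,σ) := ½[tr(ψ⁻¹φ⁻¹τ(φ)σ(ψ)) − tr(ψ⁻¹φ⁻¹σ(φ)τ(ψ))]`,
the 2-form `½ tr{ψ⁻¹φ⁻¹ dφ dψ}` evaluated on `(τ,σ)`. -/
def P2 {n : ℕ} (φ ψ : Matrix (Fin n) (Fin n) A) (τ σ : Derivation k A A) : A :=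
  half k A * (Matrix.trace (ψ⁻¹ * φ⁻¹ * dmat k A τ φ * dmat k A σ ψ)
    - Matrix.trace (ψ⁻¹ * φ⁻¹ * dmat k A σ φ * dmat k A τ ψ))

/-- `p₃(φ)(τ₁,τ₂,τ₃) := (1/6)·Σ_{π∈S₃} sgn(π)·tr(N_{π(1)} N_{π(2)} N_{π(3)})`
with `N_i = φ⁻¹·τ_i(φ)`; the 3-form `(1/6)tr{(φ⁻¹dφ)³}` evaluated on `(τ₁,τ₂,τ₃)`. -/
def p3 {n : ℕ} (φ : Matrix (Fin n) (Fin n) A) (τ₁ τ₂ τ₃ : Derivation k A A) : A :=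
  algebraMap k A 6⁻¹ *
    ∑ π : Equiv.Perm (Fin 3), (Equiv.Perm.sign π : ℤ) •
      Matrix.trace ((φ⁻¹ * dmat k A (![τ₁, τ₂, τ₃] (π 0)) φ) *
        (φ⁻¹ * dmat k A (![τ₁, τ₂, τ₃] (π 1)) φ) *
        (φ⁻¹ * dmat k A (![τ₁, τ₂, τ₃] (π 2)) φ))

/-- The cochain `p₂(φ,g)` of Section 3.5 (with `g = g_i`, `h = g_j`), evaluated on `(τ,σ)`. -/
def Qc {n : ℕ} (φ g h : Matrix (Fin n) (Fin n) A) (τ σ : Derivation k A A) : A :=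
  half k A * (Matrix.trace (φ⁻¹ * g⁻¹ * dmat k A τ g * φ * h⁻¹ * dmat k A σ h)
    - Matrix.trace (φ⁻¹ * g⁻¹ * dmat k A σ g * φ * h⁻¹ * dmat k A τ h)
    + Matrix.trace (φ⁻¹ * dmat k A τ φ * h⁻¹ * dmat k A σ h)
    - Matrix.trace (φ⁻¹ * dmat k A σ φ * h⁻¹ * dmat k A τ h)
    - Matrix.trace (g⁻¹ * dmat k A τ g * dmat k A σ φ * φ⁻¹)
    + Matrix.trace (g⁻¹ * dmat k A σ g * dmat k A τ φ * φ⁻¹))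

theorem dmat_mul {n : ℕ} (τ : Derivation k A A) (φ ψ : Matrix (Fin n) (Fin n) A) :
    dmat k A τ (φ * ψ) = dmat k A τ φ * ψ + φ * dmat k A τ ψ := by
  ext p q
  simp only [dmat, Matrix.of_apply, Matrix.mul_apply, Matrix.add_apply, map_sum,
    Derivation.leibniz, smul_eq_mul, ← Finset.sum_add_distrib]
  exact Finset.sum_congr rfl fun i _ => by ring

theorem dmat_one {n : ℕ} (τ : Derivation k A A) :
    dmat k A τ (1 : Matrix (Fin n) (Fin n) A) = 0 := by
  ext p q
  by_cases h : p = q <;> simp [dmat, Matrix.one_apply, h]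

theorem dmat_inv {n : ℕ} (τ : Derivation k A A) (g : Matrix (Fin n) (Fin n) A) [Invertible g] :
    dmat k A τ g⁻¹ = -(g⁻¹ * dmat k A τ g * g⁻¹) := by
  have h := dmat_mul k A τ g⁻¹ g
  rw [Matrix.inv_mul_of_invertible, dmat_one] at h
  rw [← neg_mul, ← eq_neg_of_add_eq_zero_left h.symm,
    Matrix.mul_inv_cancel_right_of_invertible]

/-- The gauge transformation of the trace form before antisymmetrization; the extra term is
symmetric in `τ` and `σ`. -/
theorem trace_gauge {n : ℕ} (φ ψ g₁ g₂ g₃ : Matrix (Fin n) (Fin n) A)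
    [Invertible φ] [Invertible ψ] [Invertible g₁] [Invertible g₂] [Invertible g₃]
    (τ σ : Derivation k A A) :
    Matrix.trace ((g₂ * ψ * g₃⁻¹)⁻¹ * (g₁ * φ * g₂⁻¹)⁻¹ *
        dmat k A τ (g₁ * φ * g₂⁻¹) * dmat k A σ (g₂ * ψ * g₃⁻¹))
      = Matrix.trace (ψ⁻¹ * φ⁻¹ * dmat k A τ φ * dmat k A σ ψ)
        + (Matrix.trace (ψ⁻¹ * g₂⁻¹ * dmat k A τ g₂ * ψ * g₃⁻¹ * dmat k A σ g₃)
          + Matrix.trace (ψ⁻¹ * dmat k A τ ψ * g₃⁻¹ * dmat k A σ g₃)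
          - Matrix.trace (g₂⁻¹ * dmat k A τ g₂ * dmat k A σ ψ * ψ⁻¹))
        - (Matrix.trace ((φ * ψ)⁻¹ * g₁⁻¹ * dmat k A τ g₁ * (φ * ψ) * g₃⁻¹ * dmat k A σ g₃)
          + Matrix.trace ((φ * ψ)⁻¹ * dmat k A τ (φ * ψ) * g₃⁻¹ * dmat k A σ g₃)
          - Matrix.trace (g₁⁻¹ * dmat k A τ g₁ * dmat k A σ (φ * ψ) * (φ * ψ)⁻¹))
        + (Matrix.trace (φ⁻¹ * g₁⁻¹ * dmat k A τ g₁ * φ * g₂⁻¹ * dmat k A σ g₂)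
          + Matrix.trace (φ⁻¹ * dmat k A τ φ * g₂⁻¹ * dmat k A σ g₂)
          - Matrix.trace (g₁⁻¹ * dmat k A τ g₁ * dmat k A σ φ * φ⁻¹))
        - Matrix.trace (g₂⁻¹ * dmat k A τ g₂ * (g₂⁻¹ * dmat k A σ g₂)) := by
  have conj (u X : Matrix (Fin n) (Fin n) A) [Invertible u] :
      Matrix.trace X = Matrix.trace (u * X * u⁻¹) := by
    rw [Matrix.trace_mul_comm, Matrix.inv_mul_cancel_left_of_invertible]
  rw [conj g₃⁻¹, conj ψ (g₃⁻¹ * _ * _), conj ψ (ψ⁻¹ * φ⁻¹ * dmat k A τ φ * dmat k A σ ψ),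
    conj ψ (ψ⁻¹ * g₂⁻¹ * dmat k A τ g₂ * ψ * g₃⁻¹ * dmat k A σ g₃),
    conj ψ (ψ⁻¹ * dmat k A τ ψ * g₃⁻¹ * dmat k A σ g₃),
    conj ψ ((φ * ψ)⁻¹ * g₁⁻¹ * dmat k A τ g₁ * (φ * ψ) * g₃⁻¹ * dmat k A σ g₃),
    conj ψ ((φ * ψ)⁻¹ * dmat k A τ (φ * ψ) * g₃⁻¹ * dmat k A σ g₃),
    conj φ⁻¹ (g₁⁻¹ * dmat k A τ g₁ * dmat k A σ (φ * ψ) * (φ * ψ)⁻¹),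
    conj φ⁻¹ (g₁⁻¹ * dmat k A τ g₁ * dmat k A σ φ * φ⁻¹)]
  simp only [← Matrix.trace_add, ← Matrix.trace_sub]
  congr 1
  simp only [Matrix.mul_inv_rev, Matrix.inv_inv_of_invertible, dmat_mul, dmat_inv, mul_add,
    add_mul, mul_neg, neg_mul, mul_assoc, Matrix.inv_mul_cancel_left_of_invertible,
    Matrix.mul_inv_cancel_left_of_invertible, Matrix.mul_inv_of_invertible,
    Matrix.inv_mul_of_invertible, mul_one]
  abel

/-- Section 3.5: the gauge-transformation identity
`p₂(ᵍφ) = p₂(φ) + d_Čech p₂(φ,g)` for the change of cocycle `ᵍφ_{ij} = g_i φ_{ij} g_j⁻¹`. -/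
theorem gauge_P2 {n : ℕ} (hn : 0 < n)
    (φ ψ g₁ g₂ g₃ : Matrix (Fin n) (Fin n) A)
    (hφ : IsUnit φ) (hψ : IsUnit ψ)
    (hg₁ : IsUnit g₁) (hg₂ : IsUnit g₂) (hg₃ : IsUnit g₃)
    (τ σ : Derivation k A A) :
    P2 k A (g₁ * φ * g₂⁻¹) (g₂ * ψ * g₃⁻¹) τ σ
      = P2 k A φ ψ τ σ + Qc k A ψ g₂ g₃ τ σ - Qc k A (φ * ψ) g₁ g₃ τ σ
        + Qc k A φ g₁ g₂ τ σ := by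
  obtain ⟨_⟩ := hφ.nonempty_invertible
  obtain ⟨_⟩ := hψ.nonempty_invertible
  obtain ⟨_⟩ := hg₁.nonempty_invertible
  obtain ⟨_⟩ := hg₂.nonempty_invertible
  obtain ⟨_⟩ := hg₃.nonempty_invertible
  simp only [P2, Qc]
  linear_combination half k A * (trace_gauge k A φ ψ g₁ g₂ g₃ τ σ
    - trace_gauge k A φ ψ g₁ g₂ g₃ σ τ
    - Matrix.trace_mul_comm (g₂⁻¹ * dmat k A τ g₂) (g₂⁻¹ * dmat k A σ g₂))
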